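/- Let r be a nodal root of Λ and let r^⊥ = {x ∈ Λ : ⟨x,r⟩ = 0}. Then the ℰ-submodule r^⊥ ⊕ ℰr of Λ, equipped with the restriction of the Hermitian form of Λ, is isometric (by an ℰ-linear form-preserving isomorphism) to the ℰ-module ℰ¹¹ with the Hermitian form whose Gram matrix is the 11×11 block-diagonal matrix with blocks (3), B, B, (−3), (3). -/

import Mathlib

noncomputable section

set_option synthInstance.maxHeartbeats 1000000
set_option maxHeartbeats 1000000

/-- The primitive cube root of unity `ω = e^{2πi/3}`. -/
def ω : ℂ := ⟨-1/2, Real.sqrt 3 / 2⟩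

/-- `θ = ω - ω̄`, a square root of `-3`. -/
def θ : ℂ := ω - (starRingEnd ℂ) ω

/-- The ring of Eisenstein integers `ℰ = ℤ[ω]` as a subring of ℂ. -/
def Eis : Subring ℂ := Subring.closure {ω}

/-- The Gram matrix of `E₈^ℰ`. -/
def Bmat : Matrix (Fin 4) (Fin 4) ℂ :=
  !![3, θ, 0, 0; -θ, 3, θ, 0; 0, -θ, 3, θ; 0, 0, -θ, 3]

/-- The Gram matrix of the hyperbolic cell `H`. -/
def Cmat : Matrix (Fin 2) (Fin 2) ℂ := !![0, θ; -θ, 0]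

/-- The Gram matrix of `Λ₁₀`: block diagonal with blocks B, B, C. -/
def Lam10 : Matrix (Fin 10) (Fin 10) ℂ := Matrix.of fun i j =>
  if h : i.val < 4 ∧ j.val < 4 then Bmat ⟨i.val, h.1⟩ ⟨j.val, h.2⟩
  else if h : 4 ≤ i.val ∧ i.val < 8 ∧ 4 ≤ j.val ∧ j.val < 8 then
    Bmat ⟨i.val - 4, by omega⟩ ⟨j.val - 4, by omega⟩
  else if h : 8 ≤ i.val ∧ 8 ≤ j.val then
    Cmat ⟨i.val - 8, by have := i.isLt; omega⟩ ⟨j.val - 8, by have := j.isLt; omega⟩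
  else 0

/-- The Gram matrix of `Λ = (3) ⊕ Λ₁₀`: block diagonal with blocks (3), B, B, C. -/
def Lam11 : Matrix (Fin 11) (Fin 11) ℂ := Matrix.of fun i j =>
  if i.val = 0 ∧ j.val = 0 then 3
  else if h : 1 ≤ i.val ∧ 1 ≤ j.val then
    Lam10 ⟨i.val - 1, by have := i.isLt; omega⟩ ⟨j.val - 1, by have := j.isLt; omega⟩
  else 0

/-- The Hermitian form of `Λ = ℰ¹¹`. -/
def hermE (x y : Fin 11 → Eis) : ℂ :=
  ∑ i : Fin 11, ∑ j : Fin 11, Lam11 i j * (x i : ℂ) * (starRingEnd ℂ) ((y j : ℂ))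

/-- The ideal `θℰ ⊆ ℂ`. -/
def thetaEis : Set ℂ := {z | ∃ e : Eis, z = θ * (e : ℂ)}

/-- The ideal `3ℰ ⊆ ℂ`. -/
def threeEis : Set ℂ := {z | ∃ e : Eis, z = 3 * (e : ℂ)}

/-- The set `{⟨r,x⟩ : x ∈ Λ}`. -/
def innerSetE (r : Fin 11 → Eis) : Set ℂ := {c | ∃ x : Fin 11 → Eis, c = hermE r x}

/-- The orthogonal complement `r^⊥ = {x ∈ Λ : ⟨x,r⟩ = 0}` as an `ℰ`-submodule of `Λ`. -/
def perpSub (r : Fin 11 → Eis) : Submodule Eis (Fin 11 → Eis) where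
  carrier := {x | hermE x r = 0}
  add_mem' := by
    intro a b ha hb
    have habr : hermE (a + b) r = hermE a r + hermE b r := by
      unfold hermE
      rw [← Finset.sum_add_distrib]
      refine Finset.sum_congr rfl fun i _ => ?_
      rw [← Finset.sum_add_distrib]
      refine Finset.sum_congr rfl fun j _ => ?_
      simp only [Pi.add_apply]
      push_cast
      ring
    simp only [Set.mem_setOf_eq] at ha hb ⊢
    rw [habr, ha, hb, add_zero]
  zero_mem' := by
    show hermE 0 r = 0
    unfold hermE
    simp
  smul_mem' := by
    intro c x hx
    have hcx : hermE (c • x) r = (c : ℂ) * hermE x r := by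
      unfold hermE
      rw [Finset.mul_sum]
      refine Finset.sum_congr rfl fun i _ => ?_
      rw [Finset.mul_sum]
      refine Finset.sum_congr rfl fun j _ => ?_
      simp only [Pi.smul_apply, smul_eq_mul]
      push_cast
      ring
    simp only [Set.mem_setOf_eq] at hx ⊢
    rw [hcx, hx, mul_zero]

/-- The Gram matrix which is block diagonal with blocks (3), B, B, (−3), (3). -/
def Lam11' : Matrix (Fin 11) (Fin 11) ℂ := Matrix.of fun i j =>
  if i.val = 0 ∧ j.val = 0 then 3
  else if h : 1 ≤ i.val ∧ i.val ≤ 4 ∧ 1 ≤ j.val ∧ j.val ≤ 4 then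
    Bmat ⟨i.val - 1, by omega⟩ ⟨j.val - 1, by omega⟩
  else if h : 5 ≤ i.val ∧ i.val ≤ 8 ∧ 5 ≤ j.val ∧ j.val ≤ 8 then
    Bmat ⟨i.val - 5, by omega⟩ ⟨j.val - 5, by omega⟩
  else if i.val = 9 ∧ j.val = 9 then -3
  else if i.val = 10 ∧ j.val = 10 then 3
  else 0

/-- The Hermitian form on `ℰ¹¹` with Gram matrix `(3) ⊕ B ⊕ B ⊕ (−3) ⊕ (3)`. -/
def hermE' (x y : Fin 11 → Eis) : ℂ :=
  ∑ i : Fin 11, ∑ j : Fin 11, Lam11' i j * (x i : ℂ) * (starRingEnd ℂ) ((y j : ℂ))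

lemma conj_ω : (starRingEnd ℂ) ω = -1 - ω := by
  apply Complex.ext <;> simp [ω]; norm_num

lemma ω_mul_self : ω * ω = -1 - ω := by
  have h : (Real.sqrt 3) * Real.sqrt 3 = 3 := Real.mul_self_sqrt (by norm_num)
  apply Complex.ext <;> simp [ω] <;> nlinarith

lemma θ_eq : θ = 1 + 2 * ω := by
  rw [θ, conj_ω]; ring

lemma θ_mul_self : θ * θ = -3 := by
  rw [θ_eq]; linear_combination 4 * ω_mul_self

lemma conj_θ : (starRingEnd ℂ) θ = -θ := by
  rw [θ_eq]; simp only [map_add, map_mul, map_one, Complex.conj_ofNat, conj_ω]; ring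

lemma θ_ne_zero : θ ≠ 0 := fun h => by simpa [h] using θ_mul_self

lemma ω_mem : ω ∈ Eis := Subring.subset_closure rfl

lemma θ_mem : θ ∈ Eis := by
  rw [θ_eq]
  exact add_mem (one_mem _) (mul_mem (ofNat_mem _ 2) ω_mem)

lemma mem_Eis_iff {z : ℂ} : z ∈ Eis ↔ ∃ a b : ℤ, z = a + b * ω := by
  constructor
  · intro h
    induction h using Subring.closure_induction with
    | mem x hx => exact ⟨0, 1, by simpa using hx⟩
    | zero => exact ⟨0, 0, by simp⟩
    | one => exact ⟨1, 0, by simp⟩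
    | add x y _ _ hx hy =>
      obtain ⟨a, b, rfl⟩ := hx
      obtain ⟨c, d, rfl⟩ := hy
      exact ⟨a + c, b + d, by push_cast; ring⟩
    | neg x _ hx =>
      obtain ⟨a, b, rfl⟩ := hx
      exact ⟨-a, -b, by push_cast; ring⟩
    | mul x y _ _ hx hy =>
      obtain ⟨a, b, rfl⟩ := hx
      obtain ⟨c, d, rfl⟩ := hy
      exact ⟨a * c - b * d, a * d + b * c - b * d, by
        push_cast; linear_combination (b * d : ℂ) * ω_mul_self⟩
  · rintro ⟨a, b, rfl⟩
    exact add_mem (intCast_mem _ a) (mul_mem (intCast_mem _ b) ω_mem)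

lemma conj_mem_Eis {z : ℂ} (hz : z ∈ Eis) : (starRingEnd ℂ) z ∈ Eis := by
  obtain ⟨a, b, rfl⟩ := mem_Eis_iff.1 hz
  refine mem_Eis_iff.2 ⟨a - b, -b, ?_⟩
  simp only [map_add, map_mul, map_intCast, conj_ω]
  push_cast
  ring

/-- The ideal `cℰ`, as an `ℰ`-submodule of `ℂ`. -/
def idealMul (c : ℂ) : Submodule Eis ℂ := Submodule.span Eis {c}

lemma mem_idealMul {c z : ℂ} : z ∈ idealMul c ↔ ∃ e : Eis, z = c * e := by
  rw [idealMul, Submodule.mem_span_singleton]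
  refine exists_congr fun e => ?_
  rw [Subring.smul_def, smul_eq_mul, mul_comm, eq_comm]

lemma conj_mem_idealMul_three {z : ℂ} (hz : z ∈ idealMul 3) :
    (starRingEnd ℂ) z ∈ idealMul 3 := by
  obtain ⟨e, rfl⟩ := mem_idealMul.1 hz
  exact mem_idealMul.2 ⟨⟨_, conj_mem_Eis e.2⟩, by simp [map_ofNat]⟩

lemma θ_mul_mem_idealMul_three {z : ℂ} (hz : z ∈ idealMul θ) : θ * z ∈ idealMul 3 := by
  obtain ⟨e, rfl⟩ := mem_idealMul.1 hz
  exact mem_idealMul.2 ⟨-e, by push_cast; linear_combination e * θ_mul_self⟩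

lemma div_θ_mem_idealMul_θ {z : ℂ} (hz : z ∈ idealMul 3) : z / θ ∈ idealMul θ := by
  obtain ⟨e, rfl⟩ := mem_idealMul.1 hz
  refine mem_idealMul.2 ⟨-e, ?_⟩
  rw [div_eq_iff θ_ne_zero]
  push_cast; linear_combination (e : ℂ) * θ_mul_self

lemma mem_idealMul_three_or {z : ℂ} (hz : z ∈ idealMul θ) :
    z ∈ idealMul 3 ∨ z - θ ∈ idealMul 3 ∨ z + θ ∈ idealMul 3 := by
  obtain ⟨e, rfl⟩ := mem_idealMul.1 hz
  obtain ⟨a, b, hab⟩ := mem_Eis_iff.1 e.2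
  have key (c k : ℤ) (h : a + b = 3 * k + c) : θ * e - c * θ ∈ idealMul 3 := by
    refine mem_idealMul.2 ⟨⟨k * θ + (-b : ℤ) * (1 + ω), ?_⟩, ?_⟩
    · exact add_mem (mul_mem (intCast_mem _ _) θ_mem)
        (mul_mem (intCast_mem _ _) (add_mem (one_mem _) ω_mem))
    · have h' : (a : ℂ) = 3 * k + c - b := by rw [eq_sub_iff_add_eq]; exact_mod_cast h
      simp only [hab, h', θ_eq]
      push_cast
      linear_combination (2 * b : ℂ) * ω_mul_self
  rcases (by omega : (a + b) % 3 = 0 ∨ (a + b) % 3 = 1 ∨ (a + b) % 3 = 2) with h | h | h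
  · left; simpa using key 0 ((a + b) / 3) (by omega)
  · right; left; simpa using key 1 ((a + b) / 3) (by omega)
  · right; right; simpa using key (-1) ((a + b) / 3 + 1) (by omega)

lemma θ_not_mem_idealMul_three : θ ∉ idealMul 3 := by
  intro h
  obtain ⟨e, he⟩ := mem_idealMul.1 h
  obtain ⟨a, b, hab⟩ := mem_Eis_iff.1 e.2
  have him := congrArg Complex.im he
  have hs : Real.sqrt 3 ≠ 0 := by positivity
  rw [hab, θ_eq] at him
  simp [ω] at him
  have h2 : (2 : ℝ) = 3 * b := by
    apply mul_right_cancel₀ hs; linarith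
  have h3 : (2 : ℤ) = 3 * b := by exact_mod_cast h2
  omega

lemma exists_int_of_real {z : ℂ} (hz : z ∈ idealMul θ) (hr : (starRingEnd ℂ) z = z) :
    ∃ k : ℤ, z = 3 * k := by
  obtain ⟨e, rfl⟩ := mem_idealMul.1 hz
  obtain ⟨a, b, hab⟩ := mem_Eis_iff.1 e.2
  have him := Complex.conj_eq_iff_im.1 hr
  have hs : Real.sqrt 3 ≠ 0 := by positivity
  rw [hab, θ_eq] at him
  simp [ω] at him
  have h2 : (2 * a : ℝ) = b := by
    apply mul_right_cancel₀ hs; linarith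
  have h3 : (2 * a : ℂ) = b := by exact_mod_cast h2
  refine ⟨-a, ?_⟩
  rw [hab, ← h3, θ_eq]
  push_cast
  linear_combination (4 * a : ℂ) * ω_mul_self

lemma hermE_add_left (x y z : Fin 11 → Eis) : hermE (x + y) z = hermE x z + hermE y z := by
  simp only [hermE, ← Finset.sum_add_distrib, Pi.add_apply]
  push_cast
  simp only [mul_add, add_mul]

lemma hermE_smul_left (c : Eis) (x y : Fin 11 → Eis) : hermE (c • x) y = c * hermE x y := by
  simp only [hermE, Finset.mul_sum, Pi.smul_apply, smul_eq_mul]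
  push_cast
  exact Finset.sum_congr rfl fun i _ => Finset.sum_congr rfl fun j _ => by ring

lemma conj_Bmat (i j : Fin 4) : (starRingEnd ℂ) (Bmat i j) = Bmat j i := by
  fin_cases i <;> fin_cases j <;> simp [Bmat, conj_θ, map_ofNat]

lemma conj_Cmat (i j : Fin 2) : (starRingEnd ℂ) (Cmat i j) = Cmat j i := by
  fin_cases i <;> fin_cases j <;> simp [Cmat, conj_θ]

lemma conj_Lam11 (i j : Fin 11) : (starRingEnd ℂ) (Lam11 i j) = Lam11 j i := by
  simp only [Lam11, Lam10, Matrix.of_apply]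
  split_ifs <;> first
    | omega | exact conj_Bmat _ _ | exact conj_Cmat _ _ | exact map_zero _ | exact map_ofNat _ 3

lemma conj_hermE (x y : Fin 11 → Eis) : (starRingEnd ℂ) (hermE x y) = hermE y x := by
  simp only [hermE, map_sum, map_mul, conj_Lam11, Complex.conj_conj]
  rw [Finset.sum_comm]
  exact Finset.sum_congr rfl fun i _ => Finset.sum_congr rfl fun j _ => by ring

lemma three_mem_idealMul_θ : (3 : ℂ) ∈ idealMul θ :=
  mem_idealMul.2 ⟨-⟨θ, θ_mem⟩, by push_cast; linear_combination θ_mul_self⟩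

lemma θ_mem_idealMul_θ : θ ∈ idealMul θ := mem_idealMul.2 ⟨1, by simp⟩

lemma Bmat_mem (i j : Fin 4) : Bmat i j ∈ idealMul θ := by
  fin_cases i <;> fin_cases j <;> simp [Bmat, three_mem_idealMul_θ, θ_mem_idealMul_θ]

lemma Cmat_mem (i j : Fin 2) : Cmat i j ∈ idealMul θ := by
  fin_cases i <;> fin_cases j <;> simp [Cmat, θ_mem_idealMul_θ]

lemma Lam11_mem (i j : Fin 11) : Lam11 i j ∈ idealMul θ := by
  simp only [Lam11, Lam10, Matrix.of_apply]
  split_ifs <;> first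
    | exact three_mem_idealMul_θ | exact Bmat_mem _ _ | exact Cmat_mem _ _ | exact zero_mem _

lemma hermE_mem (x y : Fin 11 → Eis) : hermE x y ∈ idealMul θ := by
  refine sum_mem fun i _ => sum_mem fun j _ => ?_
  obtain ⟨e, he⟩ := mem_idealMul.1 (Lam11_mem i j)
  exact mem_idealMul.2 ⟨e * x i * ⟨_, conj_mem_Eis (y j).2⟩, by rw [he]; push_cast; ring⟩


lemma hermE_sub_left (x y z : Fin 11 → Eis) : hermE (x - y) z = hermE x z - hermE y z :=
  eq_sub_of_add_eq (by rw [← hermE_add_left, sub_add_cancel])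

lemma hermE_neg_left (x y : Fin 11 → Eis) : hermE (-x) y = -hermE x y := by
  simpa using hermE_smul_left (-1) x y

lemma hermE_add_right (x y z : Fin 11 → Eis) : hermE x (y + z) = hermE x y + hermE x z := by
  rw [← conj_hermE, hermE_add_left, map_add, conj_hermE, conj_hermE]

lemma hermE_sub_right (x y z : Fin 11 → Eis) : hermE x (y - z) = hermE x y - hermE x z := by
  rw [← conj_hermE, hermE_sub_left, map_sub, conj_hermE, conj_hermE]

lemma hermE_neg_right (x y : Fin 11 → Eis) : hermE x (-y) = -hermE x y := by
  rw [← conj_hermE, hermE_neg_left, map_neg, conj_hermE]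

lemma hermE_smul_right (c : Eis) (x y : Fin 11 → Eis) :
    hermE x (c • y) = (starRingEnd ℂ) c * hermE x y := by
  rw [← conj_hermE, hermE_smul_left, map_mul, conj_hermE]

lemma hermE_self_mem (x : Fin 11 → Eis) : ∃ k : ℤ, hermE x x = 3 * k :=
  exists_int_of_real (hermE_mem x x) (conj_hermE x x)

lemma hermE_mem_three_comm {x y : Fin 11 → Eis} (h : hermE x y ∈ idealMul 3) :
    hermE y x ∈ idealMul 3 := by
  rw [← conj_hermE]; exact conj_mem_idealMul_three h

lemma hermE_self_mem_three (x : Fin 11 → Eis) : hermE x x ∈ idealMul 3 := by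
  obtain ⟨k, hk⟩ := hermE_self_mem x
  exact mem_idealMul.2 ⟨k, by simpa using hk⟩

/-- The index-three (or improper) sublattice `{x ∈ Λ : ⟨x,r⟩ ∈ 3ℰ}`. -/
def kerModThree (r : Fin 11 → Eis) : Submodule Eis (Fin 11 → Eis) where
  carrier := {x | hermE x r ∈ idealMul 3}
  add_mem' {x y} hx hy := by
    change hermE (x + y) r ∈ idealMul 3
    rw [hermE_add_left]; exact add_mem hx hy
  zero_mem' := by
    change hermE 0 r ∈ idealMul 3
    simp [hermE]
  smul_mem' c x hx := by
    change hermE (c • x) r ∈ idealMul 3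
    rw [hermE_smul_left]; exact Submodule.smul_mem _ c hx

lemma mem_kerModThree {r x : Fin 11 → Eis} : x ∈ kerModThree r ↔ hermE x r ∈ idealMul 3 := Iff.rfl

/-- For a root `r`, the lattice `r^⊥ ⊕ ℰr` is cut out by the congruence `⟨x,r⟩ ∈ 3ℰ`. -/
lemma perpSub_sup_span {r : Fin 11 → Eis} (hr : hermE r r = 3) :
    perpSub r ⊔ Submodule.span Eis {r} = kerModThree r := by
  apply le_antisymm
  · refine sup_le (fun x hx => ?_) ?_
    · have hx' : hermE x r = 0 := hx
      rw [mem_kerModThree, hx']; exact zero_mem _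
    · rw [Submodule.span_singleton_le_iff_mem]
      exact hermE_self_mem_three r
  · intro x hx
    obtain ⟨e, he⟩ := mem_idealMul.1 (mem_kerModThree.1 hx)
    refine Submodule.mem_sup.2 ⟨x - e • r, ?_, e • r,
      Submodule.smul_mem _ _ (Submodule.mem_span_singleton_self r), sub_add_cancel _ _⟩
    change hermE (x - e • r) r = 0
    rw [hermE_sub_left, hermE_smul_left, he, hr]; ring

/-- A sublattice of `Λ` is standard if it is isometric to `(3) ⊕ B ⊕ B ⊕ (−3) ⊕ (3)`. -/
def IsStandard (N : Submodule Eis (Fin 11 → Eis)) : Prop :=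
  ∃ f : N ≃ₗ[Eis] (Fin 11 → Eis), ∀ x y : N,
    hermE' (f x) (f y) = hermE (x : Fin 11 → Eis) (y : Fin 11 → Eis)

lemma kerModThree_neg (r : Fin 11 → Eis) : kerModThree (-r) = kerModThree r := by
  ext x
  rw [mem_kerModThree, mem_kerModThree, hermE_neg_right, neg_mem_iff]

lemma isStandard_of_isometry {r : Fin 11 → Eis} (σ : (Fin 11 → Eis) ≃ₗ[Eis] (Fin 11 → Eis))
    (hσ : ∀ x y, hermE (σ x) (σ y) = hermE x y) (h : IsStandard (kerModThree (σ r))) :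
    IsStandard (kerModThree r) := by
  have hmap : (kerModThree r).map (σ : (Fin 11 → Eis) →ₗ[Eis] (Fin 11 → Eis)) =
      kerModThree (σ r) := by
    ext y
    rw [Submodule.mem_map_equiv, mem_kerModThree, mem_kerModThree, ← hσ, σ.apply_symm_apply]
  rw [← hmap] at h
  obtain ⟨f, hf⟩ := h
  exact ⟨(σ.submoduleMap (kerModThree r)).trans f, fun x y => by simp [hf, hσ]⟩

/-- The `ℰ`-linear functional `x ↦ θ⁻¹⟨x,s⟩`. -/
def thetaForm (s : Fin 11 → Eis) : Module.Dual Eis (Fin 11 → Eis) where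
  toFun x := (mem_idealMul.1 (hermE_mem x s)).choose
  map_add' x y := by
    apply Subtype.ext
    apply mul_left_cancel₀ θ_ne_zero
    rw [Subring.coe_add, mul_add, ← (mem_idealMul.1 (hermE_mem x s)).choose_spec,
      ← (mem_idealMul.1 (hermE_mem y s)).choose_spec,
      ← (mem_idealMul.1 (hermE_mem (x + y) s)).choose_spec, hermE_add_left]
  map_smul' c x := by
    apply Subtype.ext
    apply mul_left_cancel₀ θ_ne_zero
    rw [RingHom.id_apply, smul_eq_mul, Subring.coe_mul, mul_left_comm,
      ← (mem_idealMul.1 (hermE_mem x s)).choose_spec,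
      ← (mem_idealMul.1 (hermE_mem (c • x) s)).choose_spec, hermE_smul_left]

lemma θ_mul_thetaForm (s x : Fin 11 → Eis) : θ * thetaForm s x = hermE x s :=
  (mem_idealMul.1 (hermE_mem x s)).choose_spec.symm

/-- Congruence modulo the sublattice `{z ∈ Λ : ⟨Λ,z⟩ ⊆ 3ℰ}`. -/
def CongModThree (u v : Fin 11 → Eis) : Prop := ∀ x, hermE x (u - v) ∈ idealMul 3

lemma congModThree_add_smul (u z : Fin 11 → Eis) (m : Eis) :
    CongModThree (u + ((⟨θ, θ_mem⟩ : Eis) * m) • z) u := by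
  intro x
  rw [add_sub_cancel_left, mul_smul, hermE_smul_right, conj_θ, neg_mul, neg_mem_iff]
  exact θ_mul_mem_idealMul_three (hermE_mem _ _)

lemma CongModThree.trans {u v w : Fin 11 → Eis} (h : CongModThree u v) (h' : CongModThree v w) :
    CongModThree u w := fun x => by
  rw [← sub_add_sub_cancel u v w, hermE_add_right]
  exact add_mem (h x) (h' x)

lemma CongModThree.neg {u v : Fin 11 → Eis} (h : CongModThree u v) :
    CongModThree (-u) (-v) := fun x => by
  rw [neg_sub_neg, ← neg_sub, hermE_neg_right]
  exact neg_mem (h x)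

lemma CongModThree.hermE_mem_iff {u v : Fin 11 → Eis} (h : CongModThree u v) (x : Fin 11 → Eis) :
    hermE x u ∈ idealMul 3 ↔ hermE x v ∈ idealMul 3 := by
  rw [← Submodule.sub_mem_iff_left _ (h x), hermE_sub_right, sub_sub_cancel]

lemma CongModThree.kerModThree_eq {u v : Fin 11 → Eis} (h : CongModThree u v) :
    kerModThree u = kerModThree v := Submodule.ext fun x => h.hermE_mem_iff x

/-- Unitary transvections in isotropic vectors are isometries of `Λ`. -/
lemma isStandard_of_add_thetaForm_smul {r s : Fin 11 → Eis} (hs : hermE s s = 0)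
    (h : IsStandard (kerModThree (r + thetaForm s r • s))) : IsStandard (kerModThree r) := by
  have hss : thetaForm s s = 0 := by
    have := θ_mul_thetaForm s s
    rw [hs, mul_eq_zero, or_iff_right θ_ne_zero] at this
    exact_mod_cast this
  refine isStandard_of_isometry (LinearEquiv.transvection hss) (fun x y => ?_) h
  have hsy : hermE s y = (starRingEnd ℂ) (θ * thetaForm s y) := by
    rw [θ_mul_thetaForm, conj_hermE]
  rw [LinearEquiv.transvection.apply, LinearEquiv.transvection.apply, hermE_add_left,
    hermE_add_right, hermE_add_right, hermE_smul_left, hermE_smul_left, hermE_smul_right,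
    hermE_smul_right, hs, hsy, ← θ_mul_thetaForm s x, map_mul, conj_θ]
  ring

lemma isStandard_of_add {r s : Fin 11 → Eis} (hs : hermE s s = 0)
    (hrs : hermE r s - θ ∈ idealMul 3) (h : IsStandard (kerModThree (r + s))) :
    IsStandard (kerModThree r) := by
  apply isStandard_of_add_thetaForm_smul hs
  obtain ⟨e, he⟩ := mem_idealMul.1 hrs
  have ht : thetaForm s r = 1 - (⟨θ, θ_mem⟩ : Eis) * e := by
    apply Subtype.ext
    apply mul_left_cancel₀ θ_ne_zero
    push_cast
    rw [θ_mul_thetaForm]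
    linear_combination he + e * θ_mul_self
  have hsum : r + thetaForm s r • s = r + s + ((⟨θ, θ_mem⟩ : Eis) * -e) • s := by
    rw [ht]
    module
  rwa [hsum, (congModThree_add_smul (r + s) s (-e)).kerModThree_eq]

lemma isStandard_of_sub {r s : Fin 11 → Eis} (hs : hermE s s = 0)
    (hrs : hermE r s + θ ∈ idealMul 3) (h : IsStandard (kerModThree (r - s))) :
    IsStandard (kerModThree r) := by
  refine isStandard_of_add (s := -s) ?_ ?_ (by rwa [← sub_eq_add_neg])
  · rw [hermE_neg_left, hermE_neg_right, hs, neg_zero, neg_zero]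
  · rw [hermE_neg_right, ← neg_add', neg_mem_iff]
    exact hrs

/-- A vector with nontrivial pairing against a member of a hyperbolic pair is congruent to an
isotropic vector. -/
lemma exists_isotropic {p q u : Fin 11 → Eis} (hp : hermE p p = 0) (hqp : hermE q p = θ)
    (hu : hermE u p ∉ idealMul 3) : ∃ s, hermE s s = 0 ∧ CongModThree s u := by
  have key (v : Fin 11 → Eis) (hv : hermE v p - θ ∈ idealMul 3) :
      ∃ s, hermE s s = 0 ∧ CongModThree s v := by
    obtain ⟨e, he⟩ := mem_idealMul.1 hv
    obtain ⟨v', hv'⟩ : ∃ v', v' = v + ((⟨θ, θ_mem⟩ : Eis) * e) • q := ⟨_, rfl⟩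
    have hv'p : hermE v' p = θ := by
      rw [hv', hermE_add_left, hermE_smul_left, hqp]
      push_cast
      linear_combination he + e * θ_mul_self
    have hpv' : hermE p v' = -θ := by rw [← conj_hermE, hv'p, conj_θ]
    obtain ⟨k, hk⟩ := hermE_self_mem v'
    refine ⟨v' + ((⟨θ, θ_mem⟩ : Eis) * (k * ⟨ω, ω_mem⟩)) • p, ?_,
      (congModThree_add_smul _ _ _).trans (hv' ▸ congModThree_add_smul _ _ _)⟩
    rw [hermE_add_left, hermE_add_right, hermE_add_right, hermE_smul_left, hermE_smul_left,
      hermE_smul_right, hermE_smul_right, hp, hv'p, hpv', hk]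
    push_cast
    rw [map_mul, map_mul, conj_θ, conj_ω, map_intCast]
    linear_combination (k : ℂ) * θ_mul_self
  rcases mem_idealMul_three_or (hermE_mem u p) with h | h | h
  · exact absurd h hu
  · exact key u h
  · obtain ⟨s, hs, hsu⟩ := key (-u) (by rw [hermE_neg_left, ← neg_add', neg_mem_iff]; exact h)
    exact ⟨-s, by rw [hermE_neg_left, hermE_neg_right, hs, neg_zero, neg_zero],
      by simpa using hsu.neg⟩

lemma hermE_single_nine (x : Fin 11 → Eis) : hermE x (Pi.single 9 1) = -θ * x 10 := by
  simp [hermE, Pi.single_apply, Fin.sum_univ_succ, Lam11, Lam10, Cmat]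

lemma hermE_single_ten (x : Fin 11 → Eis) : hermE x (Pi.single 10 1) = θ * x 9 := by
  simp [hermE, Pi.single_apply, Fin.sum_univ_succ, Lam11, Lam10, Cmat]

/-- The sum of the two basis vectors of the hyperbolic cell. -/
def hypSum : Fin 11 → Eis := Pi.single 9 1 + Pi.single 10 1

lemma hermE_hypSum (x : Fin 11 → Eis) : hermE x hypSum = θ * (x 9 - x 10) := by
  rw [hypSum, hermE_add_right, hermE_single_nine, hermE_single_ten]; ring

lemma hermE_hypSum_self : hermE hypSum hypSum = 0 := by
  rw [hermE_hypSum]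
  simp [hypSum]

lemma exists_isotropic_of_hypSum {u : Fin 11 → Eis} (hu : hermE u hypSum ∉ idealMul 3) :
    ∃ s, hermE s s = 0 ∧ CongModThree s u := by
  by_cases h : hermE u (Pi.single 10 1) ∈ idealMul 3
  · rw [hypSum, hermE_add_right, Submodule.add_mem_iff_left _ h] at hu
    refine exists_isotropic (p := Pi.single 9 1) (q := -Pi.single 10 1) ?_ ?_ hu <;>
      simp [hermE_single_nine]
  · refine exists_isotropic (p := Pi.single 10 1) (q := Pi.single 9 1) ?_ ?_ h <;>
      simp [hermE_single_ten]

/-- An isometric embedding of `(3) ⊕ B ⊕ B ⊕ (−3) ⊕ (3)` into `Λ`, with image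
`kerModThree hypSum`. -/
def stdEmb : (Fin 11 → Eis) →ₗ[Eis] (Fin 11 → Eis) where
  toFun y i := if i = 9 then y 9 + y 10
    else if i = 10 then (-1 - ⟨ω, ω_mem⟩) * y 9 + ⟨ω, ω_mem⟩ * y 10 else y i
  map_add' x y := by
    ext i
    simp only [Pi.add_apply]
    split_ifs <;> push_cast <;> ring
  map_smul' c x := by
    ext i
    simp only [Pi.smul_apply, smul_eq_mul, RingHom.id_apply]
    split_ifs <;> push_cast <;> ring

lemma hermE_stdEmb (x y : Fin 11 → Eis) : hermE (stdEmb x) (stdEmb y) = hermE' x y := by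
  simp [hermE, hermE', Fin.sum_univ_succ, Lam11, Lam10, Lam11', Cmat, stdEmb, conj_ω, θ_eq]
  linear_combination (4 * (x 9 * (starRingEnd ℂ) (y 9) - x 10 * (starRingEnd ℂ) (y 10)) : ℂ) *
    ω_mul_self

lemma stdEmb_nine (y : Fin 11 → Eis) : stdEmb y 9 = y 9 + y 10 := rfl

lemma stdEmb_ten (y : Fin 11 → Eis) :
    stdEmb y 10 = (-1 - ⟨ω, ω_mem⟩) * y 9 + ⟨ω, ω_mem⟩ * y 10 := rfl

lemma stdEmb_of_ne (y : Fin 11 → Eis) {i : Fin 11} (h9 : i ≠ 9) (h10 : i ≠ 10) :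
    stdEmb y i = y i := by
  change (if i = 9 then _ else if i = 10 then _ else y i) = y i
  rw [if_neg h9, if_neg h10]

lemma stdEmb_injective : Function.Injective stdEmb := by
  rw [← LinearMap.ker_eq_bot, LinearMap.ker_eq_bot']
  intro y hy
  have h9 : (y 9 : ℂ) + y 10 = 0 := by
    exact_mod_cast (stdEmb_nine y).symm.trans (congrFun hy 9)
  have h10 : (-1 - ω) * y 9 + ω * y 10 = 0 := by
    simpa using congrArg (Subtype.val) ((stdEmb_ten y).symm.trans (congrFun hy 10))
  have hy10 : (y 10 : ℂ) = 0 := by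
    refine (mul_eq_zero.1 (?_ : θ * (y 10 : ℂ) = 0)).resolve_left θ_ne_zero
    rw [θ_eq]
    linear_combination h10 + (1 + ω) * h9
  ext i
  rcases eq_or_ne i 9 with rfl | hi9
  · simpa [hy10] using h9
  rcases eq_or_ne i 10 with rfl | hi10
  · simpa using hy10
  · rw [← stdEmb_of_ne y hi9 hi10, hy]

lemma range_stdEmb : LinearMap.range stdEmb = kerModThree hypSum := by
  ext x
  rw [mem_kerModThree, hermE_hypSum, LinearMap.mem_range]
  constructor
  · rintro ⟨y, rfl⟩
    rw [stdEmb_nine, stdEmb_ten]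
    apply θ_mul_mem_idealMul_three
    refine mem_idealMul.2 ⟨(-⟨ω, ω_mem⟩) * y 9 - (1 + ⟨ω, ω_mem⟩) * y 10, ?_⟩
    rw [θ_eq]
    push_cast
    linear_combination (2 * y 9 + 2 * y 10 : ℂ) * ω_mul_self
  · intro hx
    obtain ⟨e, he⟩ := mem_idealMul.1 (div_θ_mem_idealMul_θ hx)
    rw [mul_div_cancel_left₀ _ θ_ne_zero, θ_eq] at he
    refine ⟨fun i => if i = 9 then (1 + ⟨ω, ω_mem⟩) * x 9 + e
      else if i = 10 then -⟨ω, ω_mem⟩ * x 9 - e else x i, ?_⟩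
    ext i
    rcases eq_or_ne i 9 with rfl | hi9
    · rw [stdEmb_nine, if_pos rfl, if_neg (by decide), if_pos rfl]
      push_cast
      ring
    rcases eq_or_ne i 10 with rfl | hi10
    · rw [stdEmb_ten, if_pos rfl, if_neg (by decide), if_pos rfl]
      push_cast
      linear_combination he - 2 * (x 9 : ℂ) * ω_mul_self
    · rw [stdEmb_of_ne _ hi9 hi10, if_neg hi9, if_neg hi10]

lemma isStandard_hypSum : IsStandard (kerModThree hypSum) := by
  rw [← range_stdEmb]
  refine ⟨(LinearEquiv.ofInjective stdEmb stdEmb_injective).symm, fun x y => ?_⟩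
  rw [← hermE_stdEmb]
  exact congrArg₂ hermE
    (congrArg Subtype.val ((LinearEquiv.ofInjective stdEmb stdEmb_injective).apply_symm_apply x))
    (congrArg Subtype.val ((LinearEquiv.ofInjective stdEmb stdEmb_injective).apply_symm_apply y))

lemma isStandard_of_hypSum {r : Fin 11 → Eis} (hr : hermE r hypSum ∉ idealMul 3) :
    IsStandard (kerModThree r) := by
  have key (v : Fin 11 → Eis) (hv : hermE v hypSum - θ ∈ idealMul 3) :
      IsStandard (kerModThree v) := by
    obtain ⟨s, hs, hsu⟩ := exists_isotropic_of_hypSum (u := hypSum - v) (by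
      rw [hermE_sub_left, hermE_hypSum_self, zero_sub, neg_mem_iff,
        ← sub_add_cancel (hermE v hypSum) θ, Submodule.add_mem_iff_right _ hv]
      exact θ_not_mem_idealMul_three)
    apply isStandard_of_add hs
    · have h := add_mem (sub_mem hv (hermE_self_mem_three v)) (hsu v)
      rw [hermE_sub_right, hermE_sub_right] at h
      convert h using 1
      ring
    · have h : CongModThree (v + s) hypSum := fun x => by
        have := hsu x
        rwa [sub_sub_eq_add_sub, add_comm s v] at this
      rw [h.kerModThree_eq]
      exact isStandard_hypSum
  rcases mem_idealMul_three_or (hermE_mem r hypSum) with h | h | h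
  · exact absurd h hr
  · exact key r h
  · rw [← kerModThree_neg]
    exact key (-r) (by rw [hermE_neg_left, ← neg_add', neg_mem_iff]; exact h)

lemma isStandard_of_not_mem {r x : Fin 11 → Eis} (hx : hermE r x ∉ idealMul 3) :
    IsStandard (kerModThree r) := by
  by_cases hr : hermE r hypSum ∈ idealMul 3
  swap
  · exact isStandard_of_hypSum hr
  obtain ⟨y, hry, hy⟩ : ∃ y, hermE r y ∉ idealMul 3 ∧ hermE y hypSum ∉ idealMul 3 := by
    by_cases hxw : hermE x hypSum ∈ idealMul 3
    swap
    · exact ⟨x, hx, hxw⟩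
    have he : hermE (Pi.single 9 1) hypSum = θ := by simp [hermE_hypSum]
    by_cases h : hermE r (x + Pi.single 9 1) ∈ idealMul 3
    · refine ⟨x - Pi.single 9 1, fun h' => hx ?_, ?_⟩
      · rw [hermE_add_right] at h
        rw [hermE_sub_right] at h'
        have h3 : 3 * hermE r x ∈ idealMul 3 := by
          rw [← θ_mul_thetaForm]
          exact mem_idealMul.2 ⟨⟨θ, θ_mem⟩ * thetaForm x r, rfl⟩
        convert sub_mem h3 (add_mem h h') using 1
        ring
      · rw [hermE_sub_left, he, Submodule.sub_mem_iff_right _ hxw]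
        exact θ_not_mem_idealMul_three
    · refine ⟨x + Pi.single 9 1, h, ?_⟩
      rw [hermE_add_left, he, Submodule.add_mem_iff_right _ hxw]
      exact θ_not_mem_idealMul_three
  obtain ⟨s, hs, hsy⟩ := exists_isotropic_of_hypSum hy
  have hrs : hermE r s ∉ idealMul 3 := fun h => hry ((hsy.hermE_mem_iff r).1 h)
  have hsw : hermE s hypSum ∉ idealMul 3 := fun h =>
    hy (hermE_mem_three_comm ((hsy.hermE_mem_iff _).1 (hermE_mem_three_comm h)))
  rcases mem_idealMul_three_or (hermE_mem r s) with h | h | h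
  · exact absurd h hrs
  · apply isStandard_of_add hs h (isStandard_of_hypSum _)
    rwa [hermE_add_left, Submodule.add_mem_iff_right _ hr]
  · apply isStandard_of_sub hs h (isStandard_of_hypSum _)
    rwa [hermE_sub_left, Submodule.sub_mem_iff_right _ hr]

/-- For a nodal root `r` of `Λ`, the submodule `r^⊥ ⊕ ℰr` of `Λ`, with the
restricted Hermitian form, is isometric to `ℰ¹¹` with the Hermitian form of Gram matrix
`(3) ⊕ E₈^ℰ ⊕ E₈^ℰ ⊕ (−3) ⊕ (3)`. -/
theorem stmt_10 :
    ∀ r : Fin 11 → Eis, hermE r r = 3 → innerSetE r = thetaEis →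
      ∃ f : ↥(perpSub r ⊔ Submodule.span Eis {r}) ≃ₗ[Eis] (Fin 11 → Eis),
        ∀ x y : ↥(perpSub r ⊔ Submodule.span Eis {r}),
          hermE' (f x) (f y) = hermE (x : Fin 11 → Eis) (y : Fin 11 → Eis) := by
  intro r hr hnodal
  rw [perpSub_sup_span hr]
  obtain ⟨x, hx⟩ : θ ∈ innerSetE r := by
    rw [hnodal]
    exact ⟨1, by simp⟩
  exact isStandard_of_not_mem (x := x) (hx ▸ θ_not_mem_idealMul_three)
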